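/- arXiv:1704.06880 — 2 statements merged into one kernel-verified Lean document; each statement's English description precedes it below -/
import Mathlib

section
/- Let X be a real n×d matrix, λ > 0, V̄ = XᵀX + λI_d, θ* ∈ ℝ^d with ‖θ*‖₂ ≤ S, η ∈ ℝ^n, and θ̂ = V̄⁻¹Xᵀ(Xθ* + η) the ridge estimator. Let x ∈ ℝ^d, η'₁, …, η'_k real numbers (k ≥ 1), and μ̂ = ⟨x, θ*⟩ + (1/k)·Σ_{i=1}^k η'_i. Then ⟨x, θ̂⟩ − μ̂ ≤ ‖x‖_{V̄⁻¹}·(‖Xᵀη‖_{V̄⁻¹} + λ^{1/2}·S) − (1/k)·Σ_{i=1}^k η'_i, where ‖u‖_{V̄⁻¹} = √(uᵀV̄⁻¹u). -/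
open Matrix

lemma psd_cauchy_schwarz {d : ℕ} (W : Matrix (Fin d) (Fin d) ℝ) (hT : Wᵀ = W)
    (hW : ∀ v : Fin d → ℝ, 0 ≤ v ⬝ᵥ W *ᵥ v) (u v : Fin d → ℝ) :
    u ⬝ᵥ W *ᵥ v ≤ Real.sqrt (u ⬝ᵥ W *ᵥ u) * Real.sqrt (v ⬝ᵥ W *ᵥ v) := by
  have hsym : v ⬝ᵥ W *ᵥ u = u ⬝ᵥ W *ᵥ v := by
    rw [dotProduct_mulVec, ← mulVec_transpose, hT, dotProduct_comm]
  have h : ∀ t : ℝ, 0 ≤ (v ⬝ᵥ W *ᵥ v) * (t * t) + (2 * (u ⬝ᵥ W *ᵥ v)) * t + u ⬝ᵥ W *ᵥ u := by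
    intro t
    have := hW (u + t • v)
    simp only [mulVec_add, mulVec_smul, add_dotProduct, dotProduct_add, smul_dotProduct,
      dotProduct_smul, smul_eq_mul, hsym] at this
    linarith
  have hd := discrim_le_zero h
  rw [discrim] at hd
  rw [← Real.sqrt_mul (hW u)]
  apply Real.le_sqrt_of_sq_le
  nlinarith

lemma ridge_key {n d : ℕ} (X : Matrix (Fin n) (Fin d) ℝ) (lam : ℝ) (hlam : 0 < lam)
    (W : Matrix (Fin d) (Fin d) ℝ)
    (hW : W = (Xᵀ * X + lam • (1 : Matrix (Fin d) (Fin d) ℝ))⁻¹)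
    (θ : Fin d → ℝ) (S : ℝ) (hS : Real.sqrt (θ ⬝ᵥ θ) ≤ S)
    (η : Fin n → ℝ) (x : Fin d → ℝ) :
    x ⬝ᵥ (W *ᵥ (Xᵀ *ᵥ (X *ᵥ θ + η))) - x ⬝ᵥ θ
      ≤ Real.sqrt (x ⬝ᵥ W *ᵥ x)
          * (Real.sqrt ((Xᵀ *ᵥ η) ⬝ᵥ W *ᵥ (Xᵀ *ᵥ η)) + Real.sqrt lam * S) := by
  have hG : (Xᵀ * X).PosSemidef := by
    simpa using Matrix.posSemidef_conjTranspose_mul_self X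
  have hV : (Xᵀ * X + lam • (1 : Matrix (Fin d) (Fin d) ℝ)).PosDef :=
    Matrix.PosDef.posSemidef_add hG (Matrix.PosDef.one.smul hlam)
  have hWp : W.PosDef := hW ▸ hV.inv
  have hT : Wᵀ = W := by simpa using hWp.isHermitian.eq
  have hnn : ∀ v : Fin d → ℝ, 0 ≤ v ⬝ᵥ W *ᵥ v := fun v => by
    simpa using hWp.posSemidef.dotProduct_mulVec_nonneg v
  have hdet := (Matrix.isUnit_iff_isUnit_det _).1 hV.isUnit
  have hWV : W * (Xᵀ * X + lam • (1 : Matrix (Fin d) (Fin d) ℝ)) = 1 := by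
    rw [hW]; exact Matrix.nonsing_inv_mul _ hdet
  have hVW : (Xᵀ * X + lam • (1 : Matrix (Fin d) (Fin d) ℝ)) * W = 1 := by
    rw [hW]; exact Matrix.mul_nonsing_inv _ hdet
  have e1 : W *ᵥ (Xᵀ *ᵥ (X *ᵥ θ)) + lam • (W *ᵥ θ) = θ := by
    have := congrArg (fun M => M *ᵥ θ) hWV
    simpa [Matrix.mul_add, add_mulVec, ← mulVec_mulVec, smul_mulVec] using this
  have e2 : Xᵀ *ᵥ (X *ᵥ (W *ᵥ θ)) + lam • (W *ᵥ θ) = θ := by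
    have := congrArg (fun M => M *ᵥ θ) hVW
    simpa [Matrix.add_mul, add_mulVec, ← mulVec_mulVec, smul_mulVec] using this
  have hbound : lam * (θ ⬝ᵥ W *ᵥ θ) ≤ θ ⬝ᵥ θ := by
    generalize W *ᵥ θ = w at e2
    have h1 : w ⬝ᵥ (Xᵀ *ᵥ (X *ᵥ w)) = (X *ᵥ w) ⬝ᵥ (X *ᵥ w) := by
      rw [dotProduct_mulVec, vecMul_transpose]
    have h2 : 0 ≤ (X *ᵥ w) ⬝ᵥ (X *ᵥ w) := by
      simpa using dotProduct_star_self_nonneg (X *ᵥ w)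
    generalize Xᵀ *ᵥ (X *ᵥ w) = g at *
    have h3 : 0 ≤ g ⬝ᵥ g := by
      simpa using dotProduct_star_self_nonneg g
    subst e2
    simp only [add_dotProduct, dotProduct_add, smul_dotProduct, dotProduct_smul, smul_eq_mul]
    rw [dotProduct_comm g w, h1]
    nlinarith [mul_nonneg hlam.le h2]
  have c1 := psd_cauchy_schwarz W hT hnn x (Xᵀ *ᵥ η)
  have c2 := psd_cauchy_schwarz W hT hnn x (-(lam • θ))
  have c3 : Real.sqrt ((-(lam • θ)) ⬝ᵥ W *ᵥ (-(lam • θ))) ≤ Real.sqrt lam * S := by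
    refine le_trans ?_ (mul_le_mul_of_nonneg_left hS (Real.sqrt_nonneg _))
    rw [← Real.sqrt_mul hlam.le]
    apply Real.sqrt_le_sqrt
    simp only [mulVec_neg, mulVec_smul, neg_dotProduct, dotProduct_neg, smul_dotProduct,
      dotProduct_smul, smul_eq_mul, mul_neg, neg_neg]
    exact mul_le_mul_of_nonneg_left hbound hlam.le
  have c4 := mul_le_mul_of_nonneg_left c3 (Real.sqrt_nonneg (x ⬝ᵥ W *ᵥ x))
  have e3 : x ⬝ᵥ (W *ᵥ (Xᵀ *ᵥ (X *ᵥ θ))) + lam * (x ⬝ᵥ W *ᵥ θ) = x ⬝ᵥ θ := by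
    have := congrArg (fun v => x ⬝ᵥ v) e1
    simpa only [dotProduct_add, dotProduct_smul, smul_eq_mul] using this
  have e4 : x ⬝ᵥ W *ᵥ (-(lam • θ)) = - (lam * (x ⬝ᵥ W *ᵥ θ)) := by
    simp only [mulVec_neg, mulVec_smul, dotProduct_neg, dotProduct_smul, smul_eq_mul]
  rw [mulVec_add, mulVec_add, dotProduct_add, mul_add]
  linarith


/-- Upper bound for the gap between the projected ridge estimate and the empirical mean:
`⟨x, θ̂⟩ − μ̂ ≤ ‖x‖_{V̄⁻¹}·(‖Xᵀη‖_{V̄⁻¹} + λ^{1/2}S) − (1/k)·Σ η'ᵢ`. -/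
theorem projected_ridge_minus_empirical_mean_le
    (n d k : ℕ) (hk : 1 ≤ k) (X : Matrix (Fin n) (Fin d) ℝ) (lam : ℝ) (hlam : 0 < lam)
    (θstar : Fin d → ℝ) (S : ℝ) (hS : Real.sqrt (θstar ⬝ᵥ θstar) ≤ S)
    (η : Fin n → ℝ) (x : Fin d → ℝ) (η' : Fin k → ℝ) :
    x ⬝ᵥ ((Xᵀ * X + lam • (1 : Matrix (Fin d) (Fin d) ℝ))⁻¹ *ᵥ (Xᵀ *ᵥ (X *ᵥ θstar + η)))
        - (x ⬝ᵥ θstar + (1 / (k : ℝ)) * ∑ i, η' i)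
      ≤ Real.sqrt (x ⬝ᵥ (Xᵀ * X + lam • (1 : Matrix (Fin d) (Fin d) ℝ))⁻¹ *ᵥ x)
          * (Real.sqrt ((Xᵀ *ᵥ η) ⬝ᵥ (Xᵀ * X + lam • (1 : Matrix (Fin d) (Fin d) ℝ))⁻¹
                *ᵥ (Xᵀ *ᵥ η))
             + Real.sqrt lam * S)
        - (1 / (k : ℝ)) * ∑ i, η' i := by
  have := ridge_key X lam hlam _ rfl θstar S hS η x
  linarith
end

section
/- Let X be a real n×d matrix, λ > 0, V̄ = XᵀX + λI_d, θ* ∈ ℝ^d with ‖θ*‖₂ ≤ S, η ∈ ℝ^n, and θ̂ = V̄⁻¹Xᵀ(Xθ* + η) the ridge estimator. Then ‖θ̂ − θ*‖_{V̄} ≤ ‖Xᵀη‖_{V̄⁻¹} + λ^{1/2}·S, where ‖u‖_W = √(uᵀWu) for a symmetric positive definite matrix W. -/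
open Matrix

theorem ridge_aux_triangle {d : ℕ} (V : Matrix (Fin d) (Fin d) ℝ) (hV : Vᵀ = V)
    (hpos : ∀ a : Fin d → ℝ, 0 ≤ a ⬝ᵥ V *ᵥ a) (u v : Fin d → ℝ) :
    Real.sqrt ((u + v) ⬝ᵥ V *ᵥ (u + v)) ≤
      Real.sqrt (u ⬝ᵥ V *ᵥ u) + Real.sqrt (v ⬝ᵥ V *ᵥ v) := by
  have hsym : v ⬝ᵥ V *ᵥ u = u ⬝ᵥ V *ᵥ v := by
    rw [dotProduct_mulVec, ← mulVec_transpose, hV, dotProduct_comm]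
  have hexp : ∀ t : ℝ, (u + t • v) ⬝ᵥ V *ᵥ (u + t • v) =
      (v ⬝ᵥ V *ᵥ v) * (t * t) + (2 * (u ⬝ᵥ V *ᵥ v)) * t + u ⬝ᵥ V *ᵥ u := by
    intro t
    simp only [mulVec_add, mulVec_smul, add_dotProduct, dotProduct_add, smul_dotProduct,
      dotProduct_smul, hsym, smul_eq_mul]
    ring
  have hdisc := discrim_le_zero (fun t => (hexp t) ▸ hpos (u + t • v))
  have h1 := hexp 1
  rw [one_smul] at h1
  rw [h1]
  have hu := hpos u
  have hv := hpos v
  unfold discrim at hdisc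
  apply Real.sqrt_le_iff.mpr
  refine ⟨by positivity, ?_⟩
  have hc : u ⬝ᵥ V *ᵥ v ≤ Real.sqrt (u ⬝ᵥ V *ᵥ u) * Real.sqrt (v ⬝ᵥ V *ᵥ v) := by
    rw [← Real.sqrt_mul hu]
    apply Real.le_sqrt_of_sq_le
    nlinarith
  nlinarith [Real.sq_sqrt hu, Real.sq_sqrt hv]

/-- Confidence-ellipsoid bound for the ridge estimator:
`‖θ̂ − θ*‖_{V̄} ≤ ‖Xᵀη‖_{V̄⁻¹} + λ^{1/2}·S` when `‖θ*‖₂ ≤ S`, where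
`V̄ = XᵀX + λI` and `θ̂ = V̄⁻¹Xᵀ(Xθ* + η)`. -/
theorem ridge_estimator_ellipsoid_bound
    (n d : ℕ) (X : Matrix (Fin n) (Fin d) ℝ) (lam : ℝ) (hlam : 0 < lam)
    (θstar : Fin d → ℝ) (S : ℝ) (hS : Real.sqrt (θstar ⬝ᵥ θstar) ≤ S)
    (η : Fin n → ℝ) :
    Real.sqrt
        ((((Xᵀ * X + lam • (1 : Matrix (Fin d) (Fin d) ℝ))⁻¹ *ᵥ (Xᵀ *ᵥ (X *ᵥ θstar + η)))
            - θstar) ⬝ᵥ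
          (Xᵀ * X + lam • (1 : Matrix (Fin d) (Fin d) ℝ)) *ᵥ
          (((Xᵀ * X + lam • (1 : Matrix (Fin d) (Fin d) ℝ))⁻¹ *ᵥ (Xᵀ *ᵥ (X *ᵥ θstar + η)))
            - θstar))
      ≤ Real.sqrt ((Xᵀ *ᵥ η) ⬝ᵥ
            (Xᵀ * X + lam • (1 : Matrix (Fin d) (Fin d) ℝ))⁻¹ *ᵥ (Xᵀ *ᵥ η))
        + Real.sqrt lam * S := by
  set V : Matrix (Fin d) (Fin d) ℝ := Xᵀ * X + lam • (1 : Matrix (Fin d) (Fin d) ℝ) with hVdef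
  have hVt : Vᵀ = V := by simp [hVdef, transpose_add, transpose_mul, transpose_smul]
  have hsq : ∀ {m : ℕ} (a : Fin m → ℝ), 0 ≤ a ⬝ᵥ a := fun a =>
    Finset.sum_nonneg fun i _ => mul_self_nonneg (a i)
  have hmul : ∀ a, V *ᵥ a = Xᵀ *ᵥ (X *ᵥ a) + lam • a := by
    intro a
    simp [hVdef, add_mulVec, smul_mulVec, mulVec_mulVec]
  have hG : ∀ a, a ⬝ᵥ Xᵀ *ᵥ (X *ᵥ a) = (X *ᵥ a) ⬝ᵥ (X *ᵥ a) := by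
    intro a
    rw [dotProduct_mulVec, vecMul_transpose]
  have hq : ∀ a, a ⬝ᵥ V *ᵥ a = (X *ᵥ a) ⬝ᵥ (X *ᵥ a) + lam * (a ⬝ᵥ a) := by
    intro a
    rw [hmul, dotProduct_add, hG, dotProduct_smul, smul_eq_mul]
  have hpos : ∀ a, 0 ≤ a ⬝ᵥ V *ᵥ a := by
    intro a
    rw [hq]
    have := hsq a
    have := hsq (X *ᵥ a)
    positivity
  have hdet : IsUnit V.det := by
    rw [isUnit_iff_ne_zero]
    intro h0
    obtain ⟨a, ha, hVa⟩ := exists_mulVec_eq_zero_iff.mpr h0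
    have h := hq a
    rw [hVa, dotProduct_zero] at h
    have h1 := hsq a
    have h2 := hsq (X *ᵥ a)
    have h3 : a ⬝ᵥ a = 0 := by nlinarith
    exact ha (dotProduct_self_eq_zero.mp h3)
  have hVi : ∀ a, V *ᵥ (V⁻¹ *ᵥ a) = a := fun a => by
    rw [mulVec_mulVec, mul_nonsing_inv _ hdet, one_mulVec]
  have hiV : ∀ a, V⁻¹ *ᵥ (V *ᵥ a) = a := fun a => by
    rw [mulVec_mulVec, nonsing_inv_mul _ hdet, one_mulVec]
  have hdec : V⁻¹ *ᵥ (Xᵀ *ᵥ (X *ᵥ θstar + η)) - θstar =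
      V⁻¹ *ᵥ (Xᵀ *ᵥ η) + (-lam) • (V⁻¹ *ᵥ θstar) := by
    have h : Xᵀ *ᵥ (X *ᵥ θstar + η) = V *ᵥ θstar + Xᵀ *ᵥ η + (-lam) • θstar := by
      rw [hmul, mulVec_add, neg_smul]
      abel
    rw [h, mulVec_add, mulVec_add, hiV, mulVec_smul]
    abel
  rw [hdec]
  refine (ridge_aux_triangle V hVt hpos _ _).trans (add_le_add (le_of_eq ?_) ?_)
  · rw [hVi, dotProduct_comm]
  · refine le_trans ?_ (mul_le_mul_of_nonneg_left hS (Real.sqrt_nonneg lam))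
    rw [← Real.sqrt_mul hlam.le]
    apply Real.sqrt_le_sqrt
    obtain ⟨w, hw⟩ : ∃ w, w = V⁻¹ *ᵥ θstar := ⟨_, rfl⟩
    have hθ : θstar = V *ᵥ w := by rw [hw, hVi]
    rw [← hw, hθ, mulVec_smul, smul_dotProduct, dotProduct_smul, smul_eq_mul, smul_eq_mul]
    have hn : (V *ᵥ w) ⬝ᵥ (V *ᵥ w) = (Xᵀ *ᵥ (X *ᵥ w)) ⬝ᵥ (Xᵀ *ᵥ (X *ᵥ w)) +
        lam * ((X *ᵥ w) ⬝ᵥ (X *ᵥ w)) + lam * (w ⬝ᵥ V *ᵥ w) := by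
      rw [hq, hmul]
      simp only [add_dotProduct, dotProduct_add, smul_dotProduct, dotProduct_smul, smul_eq_mul,
        dotProduct_comm (Xᵀ *ᵥ (X *ᵥ w)) w, hG]
    rw [hn]
    have h1 := hsq (Xᵀ *ᵥ (X *ᵥ w))
    have h2 := hsq (X *ᵥ w)
    have h3 : 0 ≤ lam * ((Xᵀ *ᵥ (X *ᵥ w)) ⬝ᵥ (Xᵀ *ᵥ (X *ᵥ w)) +
        lam * ((X *ᵥ w) ⬝ᵥ (X *ᵥ w))) := by positivity
    linarith
end
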